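/- Let m be a natural number, Q > 0 a real number, r a natural number, λ₁,…,λ_r positive real numbers, μ₁,…,μ_r complex numbers with Re μⱼ ≥ 0, and c : ℕ → ℂ with c(0) = c(1) = 0 and Σ_{n≥2} |c(n)| n^{−σ} < ∞ for every real σ > 1. Define, for t ≥ 0, Φ_F(t) := 4m (e^{t/2} + e^{−t/2} − 2) − Σ_{2 ≤ n ≤ e^t} (c(n)/√n)(t − log n) + [ log Q + Σ_{j=1}^r λⱼ ψ(λⱼ/2 + μⱼ) ] t + Σ_{j=1}^r λⱼ² [ Φ(1, 2, λⱼ/2 + μⱼ) − e^{−t(1/2 + μⱼ/λⱼ)} Φ(e^{−t/λⱼ}, 2, λⱼ/2 + μⱼ) ]. Then for every complex z with Im z > 1/2, setting s = 1/2 − iz, one has −∫₀^∞ Φ_F(t) e^{izt} dt = (1/z²) [ m/(s − 1) + m/s − Σ_{n≥2} c(n) n^{−s} + log Q + Σ_{j=1}^r λⱼ ψ(λⱼ s + μⱼ) ]. -/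

import Mathlib

open MeasureTheory

/-- The Lerch transcendent with second argument `2`:
`Φ(w, 2, a) = Σ_{n=0}^∞ wⁿ/(n + a)²`. -/
noncomputable def lerchPhiTwo (w a : ℂ) : ℂ := ∑' n : ℕ, w ^ n / ((n : ℂ) + a) ^ 2

/-- The digamma function `ψ = Γ'/Γ` on `ℂ`. -/
noncomputable def digammaC (w : ℂ) : ℂ := deriv Complex.Gamma w / Complex.Gamma w

section Digamma

open Complex Filter Topology

/-- Derivatives of a uniformly bounded, pointwise convergent sequence of holomorphic functions
converge at the centre of the disc. -/
lemma tendsto_deriv_of_bounded_of_tendsto {f : ℕ → ℂ → ℂ} {g : ℂ → ℂ} {z : ℂ} {R M : ℝ}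
    (hR : 0 < R) (hf : ∀ᶠ n in atTop, DifferentiableOn ℂ (f n) (Metric.closedBall z R))
    (hg : DifferentiableOn ℂ g (Metric.closedBall z R))
    (hM : ∀ᶠ n in atTop, ∀ ζ ∈ Metric.sphere z R, ‖f n ζ‖ ≤ M)
    (hlim : ∀ ζ ∈ Metric.sphere z R, Tendsto (fun n => f n ζ) atTop (𝓝 (g ζ))) :
    Tendsto (fun n => deriv (f n) z) atTop (𝓝 (deriv g z)) := by
  have hsphere (θ : ℝ) : circleMap z R θ ∈ Metric.sphere z R := circleMap_mem_sphere z hR.le θ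
  have hdiff (θ : ℝ) : circleMap z R θ - z ≠ 0 := by
    exact sub_ne_zero.mpr (circleMap_ne_center hR.ne')
  have key : Tendsto (fun n => ∮ ζ in C(z, R), (1 / (ζ - z) ^ 2) • f n ζ) atTop
      (𝓝 (∮ ζ in C(z, R), (1 / (ζ - z) ^ 2) • g ζ)) := by
    simp only [circleIntegral]
    refine intervalIntegral.tendsto_integral_filter_of_dominated_convergence
      (fun _ => R * (1 / R ^ 2 * M)) ?_ ?_ (by simp) ?_
    · filter_upwards [hf] with n hn
      refine Continuous.aestronglyMeasurable ?_
      have h1 : Continuous fun θ : ℝ => f n (circleMap z R θ) :=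
        hn.continuousOn.comp_continuous (continuous_circleMap z R)
          fun θ => Metric.sphere_subset_closedBall (hsphere θ)
      have h2 : Continuous fun θ : ℝ => 1 / (circleMap z R θ - z) ^ 2 :=
        continuous_const.div (((continuous_circleMap z R).sub continuous_const).pow 2)
          fun θ => pow_ne_zero 2 (hdiff θ)
      simp only [deriv_circleMap]
      exact ((continuous_circleMap 0 R).mul continuous_const).smul (h2.smul h1)
    · filter_upwards [hM] with n hn
      refine ae_of_all _ fun θ _ => ?_
      have h := hn _ (hsphere θ)
      have h3 : ‖circleMap z R θ - z‖ = R := by simpa [dist_eq_norm] using hsphere θ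
      have h4 : ‖circleMap 0 R θ‖ = R := by simp [abs_of_pos hR]
      simp only [deriv_circleMap, norm_smul, norm_mul, norm_div, norm_pow, h3, h4, norm_I,
        norm_one, mul_one]
      gcongr
    · exact ae_of_all _ fun θ _ => ((hlim _ (hsphere θ)).const_smul _).const_smul _
  have hI : (2 * Real.pi * I : ℂ) ≠ 0 := two_pi_I_ne_zero
  rw [hg.deriv_eq_smul_circleIntegral hR] at key
  have key2 : Tendsto (fun n => (2 * Real.pi * I : ℂ) • deriv (f n) z) atTop
      (𝓝 ((2 * Real.pi * I : ℂ) • deriv g z)) := by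
    refine key.congr' ?_
    filter_upwards [hf] with n hn
    exact hn.deriv_eq_smul_circleIntegral hR
  simpa only [smul_smul, inv_mul_cancel₀ hI, one_smul] using
    key2.const_smul (2 * Real.pi * I : ℂ)⁻¹

lemma norm_GammaSeq_le {s : ℂ} (hs : 0 < s.re) {n : ℕ} (hn : n ≠ 0) :
    ‖GammaSeq s n‖ ≤ Real.Gamma s.re := by
  have hint := Real.GammaIntegral_convergent hs
  rw [GammaSeq_eq_approx_Gamma_integral hs hn, Real.Gamma_eq_integral hs,
    intervalIntegral.integral_of_le (Nat.cast_nonneg n)]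
  calc ‖∫ x in Set.Ioc (0 : ℝ) n, (((1 - x / n) ^ n : ℝ) : ℂ) * (x : ℂ) ^ (s - 1)‖
      ≤ ∫ x in Set.Ioc (0 : ℝ) n, Real.exp (-x) * x ^ (s.re - 1) := by
        refine norm_integral_le_of_norm_le (hint.mono_set Set.Ioc_subset_Ioi_self) ?_
        filter_upwards [ae_restrict_mem measurableSet_Ioc] with x hx
        have h0 : 0 ≤ 1 - x / n := by
          have : x / n ≤ 1 := div_le_one_of_le₀ hx.2 (Nat.cast_nonneg n)
          linarith
        rw [norm_mul, norm_real, Real.norm_of_nonneg (pow_nonneg h0 n),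
          norm_cpow_eq_rpow_re_of_pos hx.1, sub_re, one_re]
        exact mul_le_mul_of_nonneg_right (Real.one_sub_div_pow_le_exp_neg hx.2)
          (Real.rpow_nonneg hx.1.le _)
    _ ≤ ∫ x in Set.Ioi (0 : ℝ), Real.exp (-x) * x ^ (s.re - 1) := by
        refine setIntegral_mono_set hint ?_ (ae_of_all _ Set.Ioc_subset_Ioi_self)
        filter_upwards [ae_restrict_mem measurableSet_Ioi] with x hx
        exact mul_nonneg (Real.exp_pos _).le (Real.rpow_nonneg (le_of_lt hx) _)

lemma add_natCast_ne_zero_of_re_pos {s : ℂ} (hs : 0 < s.re) (k : ℕ) : s + k ≠ 0 := by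
  intro h
  have := congrArg re h
  simp only [add_re, natCast_re, zero_re] at this
  have hk : (0 : ℝ) ≤ k := k.cast_nonneg
  linarith

lemma differentiableAt_GammaSeq {s : ℂ} (hs : 0 < s.re) {n : ℕ} (hn : n ≠ 0) :
    DifferentiableAt ℂ (fun z => GammaSeq z n) s := by
  unfold GammaSeq
  have hn' : (n : ℂ) ≠ 0 := Nat.cast_ne_zero.mpr hn
  refine DifferentiableAt.div ?_ (by fun_prop)
    (Finset.prod_ne_zero_iff.mpr fun k _ => add_natCast_ne_zero_of_re_pos hs k)
  exact (differentiableAt_id.const_cpow (Or.inl hn')).mul_const _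

lemma GammaSeq_ne_zero {s : ℂ} (hs : 0 < s.re) {n : ℕ} (hn : n ≠ 0) : GammaSeq s n ≠ 0 := by
  have hn' : (n : ℂ) ≠ 0 := Nat.cast_ne_zero.mpr hn
  refine div_ne_zero (mul_ne_zero (by simp [cpow_eq_zero_iff, hn']) ?_)
    (Finset.prod_ne_zero_iff.mpr fun k _ => add_natCast_ne_zero_of_re_pos hs k)
  exact_mod_cast n.factorial_ne_zero

lemma logDeriv_GammaSeq {s : ℂ} (hs : 0 < s.re) {n : ℕ} (hn : n ≠ 0) :
    logDeriv (fun z => GammaSeq z n) s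
      = log n - ∑ k ∈ Finset.range (n + 1), 1 / (s + k) := by
  have hn' : (n : ℂ) ≠ 0 := Nat.cast_ne_zero.mpr hn
  have hfac : (n.factorial : ℂ) ≠ 0 := by exact_mod_cast n.factorial_ne_zero
  have hne (k : ℕ) := add_natCast_ne_zero_of_re_pos hs k
  have hpow : HasDerivAt (fun z : ℂ => (n : ℂ) ^ z) ((n : ℂ) ^ s * log n) s := by
    simpa using (hasDerivAt_id s).const_cpow (Or.inl hn')
  have hpow0 : (n : ℂ) ^ s ≠ 0 := by simp [cpow_eq_zero_iff, hn']
  unfold GammaSeq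
  rw [logDeriv_div (f := fun z => (n : ℂ) ^ z * n.factorial) s (mul_ne_zero hpow0 hfac) (Finset.prod_ne_zero_iff.mpr fun k _ => hne k)
    (hpow.differentiableAt.mul_const _) (by fun_prop), logDeriv_mul_const _ _ hfac,
    logDeriv_prod (fun k _ => hne k) (fun k _ => by fun_prop)]
  congr 1
  · rw [logDeriv_apply, hpow.deriv, mul_div_cancel_left₀ _ hpow0]
  · refine Finset.sum_congr rfl fun k _ => ?_
    rw [logDeriv_apply]
    simp

lemma tendsto_logDeriv_GammaSeq {s : ℂ} (hs : 0 < s.re) :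
    Tendsto (fun n => logDeriv (fun z => GammaSeq z n) s) atTop (𝓝 (digammaC s)) := by
  have hre {ζ : ℂ} (hζ : ζ ∈ Metric.closedBall s (s.re / 2)) : 0 < ζ.re := by
    have h1 := (abs_re_le_norm (ζ - s)).trans (mem_closedBall_iff_norm.mp hζ)
    have h2 := (abs_le.mp h1).1
    rw [sub_re] at h2
    linarith
  have hcont : ContinuousOn (fun ζ : ℂ => Real.Gamma ζ.re) (Metric.sphere s (s.re / 2)) := by
    intro ζ hζ
    have hpos := hre (Metric.sphere_subset_closedBall hζ)
    refine ContinuousAt.continuousWithinAt ?_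
    refine ContinuousAt.comp (f := re) (g := Real.Gamma) ?_ continuous_re.continuousAt
    refine (Real.differentiableAt_Gamma fun m hm => ?_).continuousAt
    have : (0 : ℝ) ≤ m := m.cast_nonneg
    linarith
  obtain ⟨M, hM⟩ := (isCompact_sphere s (s.re / 2)).bddAbove_image hcont
  have hderiv := tendsto_deriv_of_bounded_of_tendsto (f := fun n z => GammaSeq z n) (g := Gamma)
    (M := M) (half_pos hs)
    ((eventually_ne_atTop 0).mono fun n hn ζ hζ =>
      (differentiableAt_GammaSeq (hre hζ) hn).differentiableWithinAt)
    (fun ζ hζ => (differentiableAt_Gamma ζ fun m hm => by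
      have := hre hζ
      rw [hm, neg_re, natCast_re] at this
      have h0 : (0 : ℝ) ≤ m := m.cast_nonneg
      linarith).differentiableWithinAt)
    ((eventually_ne_atTop 0).mono fun n hn ζ hζ =>
      (norm_GammaSeq_le (hre (Metric.sphere_subset_closedBall hζ)) hn).trans
        (hM (Set.mem_image_of_mem _ hζ)))
    (fun ζ _ => GammaSeq_tendsto_Gamma ζ)
  exact hderiv.div (GammaSeq_tendsto_Gamma s) (Gamma_ne_zero_of_re_pos hs)

lemma natCast_le_norm_natCast_add {a : ℂ} (ha : 0 < a.re) (n : ℕ) : (n : ℝ) ≤ ‖(n : ℂ) + a‖ := by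
  refine le_trans ?_ (re_le_norm _)
  simp [ha.le]

lemma summable_inv_natCast_add_mul {a b : ℂ} (ha : 0 < a.re) (hb : 0 < b.re) :
    Summable fun n : ℕ => ‖(1 : ℂ) / (((n : ℂ) + a) * ((n : ℂ) + b))‖ := by
  rw [← summable_nat_add_iff 1]
  refine Summable.of_nonneg_of_le (fun _ => norm_nonneg _) (fun n => ?_)
    ((summable_nat_add_iff 1).mpr (Real.summable_one_div_nat_pow.mpr one_lt_two))
  rw [norm_div, norm_one, norm_mul, sq]
  have h0 : (0 : ℝ) < ((n + 1 : ℕ) : ℝ) := by exact_mod_cast n.succ_pos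
  gcongr
  · exact natCast_le_norm_natCast_add ha _
  · exact natCast_le_norm_natCast_add hb _

/-- `ψ(b) - ψ(a) = Σ (b - a) / ((n + a) (n + b))`. -/
lemma hasSum_digammaC_sub {a b : ℂ} (ha : 0 < a.re) (hb : 0 < b.re) :
    HasSum (fun n : ℕ => (b - a) * (1 / (((n : ℂ) + a) * ((n : ℂ) + b))))
      (digammaC b - digammaC a) := by
  have hsum := ((summable_inv_natCast_add_mul ha hb).of_norm.mul_left (b - a)).hasSum
  suffices h : digammaC b - digammaC a =
      ∑' n : ℕ, (b - a) * (1 / (((n : ℂ) + a) * ((n : ℂ) + b))) by rwa [h]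
  refine tendsto_nhds_unique ((tendsto_logDeriv_GammaSeq hb).sub (tendsto_logDeriv_GammaSeq ha)) ?_
  refine (hsum.tendsto_sum_nat.comp (tendsto_add_atTop_nat 1)).congr' ?_
  filter_upwards [eventually_ne_atTop 0] with n hn
  rw [logDeriv_GammaSeq hb hn, logDeriv_GammaSeq ha hn, sub_sub_sub_cancel_left,
    ← Finset.sum_sub_distrib]
  refine Finset.sum_congr rfl fun k _ => ?_
  have h1 := add_natCast_ne_zero_of_re_pos ha k
  have h2 := add_natCast_ne_zero_of_re_pos hb k
  rw [add_comm (k : ℂ) a, add_comm (k : ℂ) b]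
  field_simp
  ring

end Digamma

/-- The Laplace transform of `f` converges absolutely at `w`, with value `L`. -/
def HasLaplace (f : ℝ → ℂ) (w L : ℂ) : Prop :=
  IntegrableOn (fun t : ℝ => f t * Complex.exp (-w * t)) (Set.Ioi 0) ∧
    ∫ t in Set.Ioi (0 : ℝ), f t * Complex.exp (-w * t) = L

namespace HasLaplace

open Complex Filter Topology

variable {f g : ℝ → ℂ} {w L M : ℂ}

lemma add (hf : HasLaplace f w L) (hg : HasLaplace g w M) :
    HasLaplace (fun t => f t + g t) w (L + M) := by
  constructor
  · simp only [add_mul]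
    exact hf.1.add hg.1
  · simp only [add_mul]
    rw [integral_add hf.1 hg.1, hf.2, hg.2]

lemma const_mul (hf : HasLaplace f w L) (k : ℂ) : HasLaplace (fun t => k * f t) w (k * L) := by
  constructor
  · simp only [mul_assoc]
    exact Integrable.const_mul hf.1 k
  · simp only [mul_assoc]
    rw [integral_const_mul, hf.2]

lemma sub (hf : HasLaplace f w L) (hg : HasLaplace g w M) :
    HasLaplace (fun t => f t - g t) w (L - M) := by
  simpa only [neg_one_mul, ← sub_eq_add_neg] using hf.add (hg.const_mul (-1))

lemma sum {ι : Type*} (s : Finset ι) {f : ι → ℝ → ℂ} {L : ι → ℂ}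
    (h : ∀ i ∈ s, HasLaplace (f i) w (L i)) :
    HasLaplace (fun t => ∑ i ∈ s, f i t) w (∑ i ∈ s, L i) := by
  constructor
  · simp only [Finset.sum_mul]
    exact integrable_finsetSum s fun i hi => (h i hi).1
  · simp only [Finset.sum_mul]
    rw [integral_finsetSum s fun i hi => (h i hi).1]
    exact Finset.sum_congr rfl fun i hi => (h i hi).2

lemma congr (hf : HasLaplace f w L) (h : ∀ t : ℝ, 0 < t → g t = f t) : HasLaplace g w L := by
  constructor
  · exact hf.1.congr_fun (fun t ht => by simp only [h t ht]) measurableSet_Ioi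
  · rw [← hf.2]
    exact setIntegral_congr_fun measurableSet_Ioi fun t ht => by simp only [h t ht]

lemma exp_mul {α : ℂ} (h : α.re < w.re) :
    HasLaplace (fun t => exp (α * t)) w (1 / (w - α)) := by
  have hre : (α - w).re < 0 := by simpa using h
  have heq : (fun t : ℝ => exp (α * t) * exp (-w * t)) = fun t : ℝ => exp ((α - w) * t) := by
    ext t
    rw [← exp_add]
    ring_nf
  constructor
  · rw [heq]
    exact integrableOn_exp_mul_complex_Ioi hre 0
  · rw [heq, integral_exp_mul_complex_Ioi hre 0, ofReal_zero, mul_zero, exp_zero, neg_div,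
      ← div_neg, neg_sub]

lemma one (h : 0 < w.re) : HasLaplace (fun _ => 1) w (1 / w) := by
  simpa using exp_mul (α := 0) (by simpa using h)

lemma norm_exp_neg_mul_ofReal (w : ℂ) (t : ℝ) : ‖exp (-w * t)‖ = Real.exp (-w.re * t) := by
  rw [norm_exp]
  simp

lemma ofReal (h : 0 < w.re) : HasLaplace (fun t => (t : ℂ)) w (1 / w ^ 2) := by
  have hw : w ≠ 0 := fun h0 => by simp [h0] at h
  have hint : IntegrableOn (fun t : ℝ => (t : ℂ) * exp (-w * t)) (Set.Ioi 0) := by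
    refine (integrable_norm_iff (Continuous.aestronglyMeasurable (by fun_prop))).mp ?_
    have h1 := integrableOn_rpow_mul_exp_neg_mul_rpow (p := 1) (s := 1) (by norm_num) one_pos h
    refine h1.congr_fun (fun t ht => ?_) measurableSet_Ioi
    simp only [Real.rpow_one, norm_mul, norm_real, norm_exp_neg_mul_ofReal,
      Real.norm_of_nonneg (le_of_lt ht)]
  refine ⟨hint, ?_⟩
  have hderiv (t : ℝ) : HasDerivAt (fun t : ℝ => -((t : ℂ) / w + 1 / w ^ 2) * exp (-w * t))
      ((t : ℂ) * exp (-w * t)) t := by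
    have h1 : HasDerivAt (fun t : ℝ => (t : ℂ)) 1 t := Complex.ofRealCLM.hasDerivAt
    have h2 := (((h1.div_const w).add_const (1 / w ^ 2)).neg).mul (h1.const_mul (-w)).cexp
    refine h2.congr_deriv ?_
    simp only [Pi.neg_apply]
    field_simp
    ring
  have hlim : Tendsto (fun t : ℝ => -((t : ℂ) / w + 1 / w ^ 2) * exp (-w * t)) atTop (𝓝 0) := by
    have h0 : Tendsto (fun t : ℝ => exp (-w * t)) atTop (𝓝 0) := by
      rw [tendsto_zero_iff_norm_tendsto_zero]
      simp only [norm_exp_neg_mul_ofReal]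
      exact Real.tendsto_exp_atBot.comp (tendsto_id.const_mul_atTop_of_neg (by simpa using h))
    have h1 : Tendsto (fun t : ℝ => (t : ℂ) * exp (-w * t)) atTop (𝓝 0) := by
      rw [tendsto_zero_iff_norm_tendsto_zero]
      refine (tendsto_rpow_mul_exp_neg_mul_atTop_nhds_zero 1 w.re h).congr' ?_
      filter_upwards [eventually_ge_atTop 0] with t ht
      simp only [Real.rpow_one, norm_mul, norm_real, norm_exp_neg_mul_ofReal,
        Real.norm_of_nonneg ht]
    have h2 := (h1.const_mul (-1 / w)).add (h0.const_mul (-1 / w ^ 2))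
    simp only [mul_zero, add_zero] at h2
    refine h2.congr fun t => ?_
    ring
  rw [integral_Ioi_of_hasDerivAt_of_tendsto' (fun t _ => hderiv t) hint hlim]
  simp

lemma max_sub {l : ℝ} (hl : 0 ≤ l) (h : 0 < w.re) :
    HasLaplace (fun t => ((max (t - l) 0 : ℝ) : ℂ)) w (exp (-w * l) / w ^ 2) := by
  obtain ⟨h1, h2⟩ := HasLaplace.ofReal h
  set G : ℝ → ℂ := (Set.Ioi 0).indicator fun t : ℝ => (t : ℂ) * exp (-w * t) with hG
  have hGint : Integrable G := (integrable_indicator_iff measurableSet_Ioi).mpr h1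
  have heq : (fun t : ℝ => ((max (t - l) 0 : ℝ) : ℂ) * exp (-w * t))
      = fun t : ℝ => exp (-w * l) * G (t - l) := by
    ext t
    rcases lt_or_ge 0 (t - l) with ht | ht
    · rw [hG, Set.indicator_of_mem (Set.mem_Ioi.mpr ht), max_eq_left ht.le, mul_left_comm,
        ← exp_add]
      push_cast
      ring_nf
    · rw [hG, Set.indicator_of_notMem (by simpa using ht), max_eq_right ht]
      simp
  have hint := (hGint.comp_sub_right l).const_mul (exp (-w * l))
  unfold HasLaplace
  simp only [funext_iff] at heq
  simp only [heq]
  refine ⟨hint.integrableOn, ?_⟩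
  rw [setIntegral_eq_integral_of_forall_compl_eq_zero, integral_const_mul,
    integral_sub_right_eq_self G l, hG, integral_indicator measurableSet_Ioi, h2, mul_one_div]
  intro t ht
  have : t - l ∉ Set.Ioi (0 : ℝ) := by
    simp only [Set.mem_Ioi, not_lt] at ht ⊢
    linarith
  rw [hG, Set.indicator_of_notMem this, mul_zero]

lemma integral_norm_max_sub {l : ℝ} (hl : 0 ≤ l) (h : 0 < w.re) :
    ∫ t in Set.Ioi (0 : ℝ), ‖((max (t - l) 0 : ℝ) : ℂ) * exp (-w * t)‖
      = Real.exp (-w.re * l) / w.re ^ 2 := by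
  have key := (max_sub (w := (w.re : ℂ)) hl (by simpa using h)).2
  rw [← ofReal_inj]
  push_cast
  rw [← key]
  refine integral_ofReal.symm.trans ?_
  congr 1 with t
  rw [norm_mul, norm_exp_neg_mul_ofReal, norm_real, Real.norm_of_nonneg (le_max_right _ _)]
  exact (by push_cast; rfl : ((max (t - l) 0 * Real.exp (-w.re * t) : ℝ) : ℂ)
    = ((max (t - l) 0 : ℝ) : ℂ) * exp (-(w.re : ℂ) * t))

lemma integral_norm_exp_neg (h : 0 < w.re) :
    ∫ t in Set.Ioi (0 : ℝ), ‖exp (-w * t)‖ = 1 / w.re := by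
  simp only [norm_exp_neg_mul_ofReal]
  rw [integral_exp_mul_Ioi (by simpa using h)]
  simp

lemma hasSum {f : ℕ → ℝ → ℂ} {L : ℕ → ℂ} {F : ℝ → ℂ} (hf : ∀ n, HasLaplace (f n) w (L n))
    (hsum : Summable fun n => ∫ t in Set.Ioi (0 : ℝ), ‖f n t * exp (-w * t)‖)
    (hF : ∀ t : ℝ, 0 < t → HasSum (fun n => f n t) (F t)) :
    HasLaplace F w (∑' n, L n) := by
  have hF' (t : ℝ) (ht : 0 < t) :
      HasSum (fun n => f n t * exp (-w * t)) (F t * exp (-w * t)) := (hF t ht).mul_right _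
  have hae : (fun t : ℝ => ∑' n, f n t * exp (-w * t)) =ᵐ[volume.restrict (Set.Ioi 0)]
      fun t => F t * exp (-w * t) := by
    filter_upwards [ae_restrict_mem measurableSet_Ioi] with t ht using (hF' t ht).tsum_eq
  constructor
  · have hmeas : AEStronglyMeasurable (fun t : ℝ => F t * exp (-w * t))
        (volume.restrict (Set.Ioi 0)) := by
      refine aestronglyMeasurable_of_tendsto_ae atTop
        (f := fun N : ℕ => fun t : ℝ => ∑ n ∈ Finset.range N, f n t * exp (-w * t)) (fun N => ?_) ?_
      · exact (integrable_finsetSum _ fun n _ => (hf n).1).1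
      · filter_upwards [ae_restrict_mem measurableSet_Ioi] with t ht
          using (hF' t ht).tendsto_sum_nat
    refine ⟨hmeas, ?_⟩
    calc ∫⁻ t in Set.Ioi (0 : ℝ), ‖F t * exp (-w * t)‖ₑ
        ≤ ∫⁻ t in Set.Ioi (0 : ℝ), ∑' n, ‖f n t * exp (-w * t)‖ₑ := by
          refine lintegral_mono_ae ?_
          filter_upwards [hae] with t ht
          rw [← ht]
          exact enorm_tsum_le_tsum_enorm
      _ = ∑' n, ∫⁻ t in Set.Ioi (0 : ℝ), ‖f n t * exp (-w * t)‖ₑ :=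
          lintegral_tsum fun n => (hf n).1.1.enorm
      _ = ∑' n, ENNReal.ofReal (∫ t in Set.Ioi (0 : ℝ), ‖f n t * exp (-w * t)‖) := by
          congr 1 with n
          exact (ofReal_integral_norm_eq_lintegral_enorm (hf n).1).symm
      _ < ⊤ := by
          rw [← ENNReal.ofReal_tsum_of_nonneg
            (fun n => integral_nonneg fun t => norm_nonneg _) hsum]
          exact ENNReal.ofReal_lt_top
  · rw [← integral_congr_ae hae,
      ← (hasSum_integral_of_summable_integral_norm (fun n => (hf n).1) hsum).tsum_eq]
    exact tsum_congr fun n => (hf n).2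

end HasLaplace

/-- The Laplace transform of `t ↦ Σ_{2 ≤ n ≤ e^t} c(n) n^{-1/2} (t - log n)`. -/
lemma hasLaplace_sum_Icc_floor_exp {c : ℕ → ℂ} (hc0 : c 0 = 0) (hc1 : c 1 = 0)
    (hc : ∀ σ : ℝ, 1 < σ → Summable fun n : ℕ => ‖c n‖ / (n : ℝ) ^ σ) {w : ℂ}
    (hw : 1 / 2 < w.re) :
    HasLaplace
      (fun t => ∑ n ∈ Finset.Icc 2 ⌊Real.exp t⌋₊,
        (c n / (Real.sqrt n : ℂ)) * ((t : ℂ) - Real.log n)) w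
      (1 / w ^ 2 * ∑' n : ℕ, c n * Complex.exp (-(1 / 2 + w) * Real.log n)) := by
  have hw0 : 0 < w.re := by linarith
  have hlog (n : ℕ) : 0 ≤ Real.log n := Real.log_natCast_nonneg n
  have hterm (n : ℕ) := (HasLaplace.max_sub (hlog n) hw0).const_mul (c n / (Real.sqrt n : ℂ))
  have hsqrt (n : ℕ) (hn : n ≠ 0) : Real.sqrt n = Real.exp (1 / 2 * Real.log n) := by
    have hn' : (0 : ℝ) < n := by exact_mod_cast Nat.pos_of_ne_zero hn
    rw [Real.sqrt_eq_rpow, Real.rpow_def_of_pos hn', mul_comm]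
  rw [← tsum_mul_left]
  have hL (n : ℕ) : 1 / w ^ 2 * (c n * Complex.exp (-(1 / 2 + w) * Real.log n))
      = c n / (Real.sqrt n : ℂ) * (Complex.exp (-w * Real.log n) / w ^ 2) := by
    rcases eq_or_ne n 0 with rfl | hn
    · simp [hc0]
    · rw [hsqrt n hn, neg_add, add_mul, Complex.exp_add, neg_mul, Complex.exp_neg]
      push_cast
      ring
  simp only [hL]
  refine HasLaplace.hasSum hterm ?_ ?_
  · refine ((hc (1 / 2 + w.re) (by linarith)).mul_right (1 / w.re ^ 2)).congr fun n => ?_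
    have hnorm (t : ℝ) : ‖c n / (Real.sqrt n : ℂ) * ((max (t - Real.log n) 0 : ℝ) : ℂ)
          * Complex.exp (-w * t)‖ = ‖c n / (Real.sqrt n : ℂ)‖
          * ‖((max (t - Real.log n) 0 : ℝ) : ℂ) * Complex.exp (-w * t)‖ := by
      rw [mul_assoc, norm_mul]
    simp only [hnorm]
    rw [integral_const_mul, HasLaplace.integral_norm_max_sub (hlog n) hw0]
    rcases eq_or_ne n 0 with rfl | hn
    · simp [hc0]
    · have hn' : (0 : ℝ) < n := by exact_mod_cast Nat.pos_of_ne_zero hn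
      rw [norm_div, Complex.norm_real, Real.norm_of_nonneg (Real.sqrt_nonneg _), hsqrt n hn,
        Real.rpow_def_of_pos hn', mul_add, Real.exp_add, neg_mul, Real.exp_neg]
      ring_nf
  · intro t ht
    have heq : ∑ n ∈ Finset.Icc 2 ⌊Real.exp t⌋₊,
        (c n / (Real.sqrt n : ℂ)) * ((t : ℂ) - Real.log n)
        = ∑ n ∈ Finset.Icc 2 ⌊Real.exp t⌋₊,
          (c n / (Real.sqrt n : ℂ)) * ((max (t - Real.log n) 0 : ℝ) : ℂ) := by
      refine Finset.sum_congr rfl fun n hn => ?_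
      rw [Finset.mem_Icc, Nat.le_floor_iff (Real.exp_pos t).le] at hn
      have hn' : (0 : ℝ) < n := by exact_mod_cast (by omega : 0 < n)
      have := (Real.log_le_iff_le_exp hn').mpr hn.2
      rw [max_eq_left (by linarith)]
      push_cast
      ring
    rw [heq]
    refine hasSum_sum_of_ne_finset_zero fun n hn => ?_
    rcases lt_or_ge n 2 with h | h
    · interval_cases n <;> simp [hc0, hc1]
    · have hn' : (0 : ℝ) < n := by exact_mod_cast (by omega : 0 < n)
      have hlt : Real.exp t < n := by
        rw [Finset.mem_Icc, Nat.le_floor_iff (Real.exp_pos t).le] at hn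
        by_contra! h'
        exact hn ⟨h, h'⟩
      have := (Real.lt_log_iff_exp_lt hn').mpr hlt
      rw [max_eq_right (by linarith)]
      simp

lemma hasSum_lerchPhiTwo {w a : ℂ} (hw : ‖w‖ ≤ 1) (ha : 0 < a.re) :
    HasSum (fun n : ℕ => w ^ n / ((n : ℂ) + a) ^ 2) (lerchPhiTwo w a) := by
  refine Summable.hasSum (Summable.of_norm_bounded (summable_inv_natCast_add_mul ha ha) fun n => ?_)
  rw [norm_div, norm_div, norm_pow, norm_one, sq]
  gcongr
  exact pow_le_one₀ (norm_nonneg _) hw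

/-- The Laplace transform of `t ↦ λ² (Φ(1, 2, a) - e^{-at/λ} Φ(e^{-t/λ}, 2, a))`. -/
lemma hasLaplace_lerchPhiTwo {l : ℝ} (hl : 0 < l) {a : ℂ} (ha : 0 < a.re) {w : ℂ}
    (hw : 0 < w.re) :
    HasLaplace
      (fun t => (l : ℂ) ^ 2 * (lerchPhiTwo 1 a
        - Complex.exp (-(t : ℂ) * (a / l)) * lerchPhiTwo (Complex.exp (-(t : ℂ) / l)) a)) w
      (1 / w ^ 2 * (l * (digammaC (a + l * w) - digammaC a))) := by
  have hl0 : (l : ℂ) ≠ 0 := by exact_mod_cast hl.ne'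
  have hw0 : w ≠ 0 := fun h0 => by simp [h0] at hw
  have hre : ∀ n : ℕ, 0 < (((n : ℂ) + a) / l).re := fun n => by
    rw [Complex.div_ofReal_re]
    simp only [Complex.add_re, Complex.natCast_re]
    positivity
  have hre' (n : ℕ) : (-(((n : ℂ) + a) / l)).re < w.re := by
    rw [Complex.neg_re]
    linarith [hre n]
  have hb : 0 < (a + l * w).re := by
    simp only [Complex.add_re, Complex.re_ofReal_mul]
    positivity
  have hterm (n : ℕ) := ((HasLaplace.one hw).sub (HasLaplace.exp_mul (hre' n))).const_mul
    (1 / ((n : ℂ) + a) ^ 2)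
  have hsum : HasLaplace (fun t => lerchPhiTwo 1 a
        - Complex.exp (-(t : ℂ) * (a / l)) * lerchPhiTwo (Complex.exp (-(t : ℂ) / l)) a) w
      (∑' n : ℕ, 1 / ((n : ℂ) + a) ^ 2 * (1 / w - 1 / (w - -(((n : ℂ) + a) / l)))) := by
    refine HasLaplace.hasSum hterm ?_ fun t ht => ?_
    · refine Summable.of_nonneg_of_le (fun n => integral_nonneg fun t => norm_nonneg _)
        (fun n => ?_) ((summable_inv_natCast_add_mul ha ha).mul_right (2 * (1 / w.re)))
      rw [← HasLaplace.integral_norm_exp_neg hw, ← integral_const_mul, ← integral_const_mul]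
      have hint : IntegrableOn (fun t : ℝ => Complex.exp (-w * t)) (Set.Ioi 0) := by
        simpa only [one_mul] using (HasLaplace.one hw).1
      refine setIntegral_mono_on (hterm n).1.norm ((hint.norm.const_mul _).const_mul _)
        measurableSet_Ioi fun t ht => ?_
      have hexp : ‖Complex.exp (-(((n : ℂ) + a) / l) * t)‖ ≤ 1 := by
        rw [HasLaplace.norm_exp_neg_mul_ofReal]
        exact Real.exp_le_one_iff.mpr (by
          rw [neg_mul]
          exact neg_nonpos.mpr (mul_nonneg (hre n).le (le_of_lt ht)))
      have h2 : ‖1 - Complex.exp (-(((n : ℂ) + a) / l) * t)‖ ≤ 2 := by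
        refine (norm_sub_le _ _).trans ?_
        rw [norm_one]
        linarith
      rw [norm_mul, norm_mul, mul_assoc, ← sq]
      gcongr
    · have hnorm : ‖Complex.exp (-(t : ℂ) / l)‖ ≤ 1 := by
        rw [Complex.norm_exp, Complex.div_ofReal_re]
        refine Real.exp_le_one_iff.mpr ?_
        simp only [Complex.neg_re, Complex.ofReal_re]
        exact div_nonpos_of_nonpos_of_nonneg (by linarith) hl.le
      have h1 := hasSum_lerchPhiTwo (w := 1) (by simp) ha
      have h2 := (hasSum_lerchPhiTwo hnorm ha).mul_left (Complex.exp (-(t : ℂ) * (a / l)))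
      refine (h1.sub h2).congr_fun ?_
      intro n
      have : Complex.exp (-(((n : ℂ) + a) / l) * t)
          = Complex.exp (-(t : ℂ) * (a / l)) * Complex.exp (-(t : ℂ) / l) ^ n := by
        rw [← Complex.exp_nat_mul, ← Complex.exp_add]
        ring_nf
      rw [this]
      ring
  convert hsum.const_mul ((l : ℂ) ^ 2) using 1
  rw [← (hasSum_digammaC_sub ha hb).tsum_eq, ← tsum_mul_left, ← tsum_mul_left, ← tsum_mul_left]
  refine tsum_congr fun n => ?_
  have h1 : (n : ℂ) + a ≠ 0 := by
    rw [add_comm]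
    exact add_natCast_ne_zero_of_re_pos ha n
  have h2 : (n : ℂ) + (a + l * w) ≠ 0 := by
    rw [add_comm]
    exact add_natCast_ne_zero_of_re_pos hb n
  have h3 : w - -(((n : ℂ) + a) / l) = ((n : ℂ) + (a + l * w)) / l := by
    field_simp
    ring
  rw [h3]
  generalize hu : (n : ℂ) + (a + l * w) = u at *
  have hu' : l * w = u - (n + a) := by rw [← hu]; ring
  rw [add_sub_cancel_left]
  field_simp
  linear_combination hu'

/-- the zero-free Laplace-transform identity for the function `Φ_F`
attached to data `(m, Q, (λⱼ), (μⱼ), c)` of a member of the semi-extended Selberg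
class: for every `z` with `Im z > 1/2` and `s = 1/2 − iz`,
`−∫₀^∞ Φ_F(t) e^{izt} dt
  = (1/z²)[ m/(s−1) + m/s − Σ_{n≥2} c(n) n^{−s} + log Q + Σⱼ λⱼ ψ(λⱼ s + μⱼ) ]`. -/
theorem integral_PhiF (m : ℕ) (Q : ℝ) (hQ : 0 < Q) (r : ℕ)
    (lam : Fin r → ℝ) (hlam : ∀ j, 0 < lam j)
    (μ : Fin r → ℂ) (hμ : ∀ j, 0 ≤ (μ j).re)
    (c : ℕ → ℂ) (hc0 : c 0 = 0) (hc1 : c 1 = 0)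
    (hc : ∀ σ : ℝ, 1 < σ → Summable fun n : ℕ => ‖c n‖ / (n : ℝ) ^ σ)
    (z : ℂ) (hz : 1 / 2 < z.im) (s : ℂ) (hs : s = 1 / 2 - Complex.I * z) :
    -(∫ t in Set.Ioi (0 : ℝ),
        ((4 : ℂ) * (m : ℂ) * (Complex.exp ((t : ℂ) / 2) + Complex.exp (-(t : ℂ) / 2) - 2)
          - (∑ n ∈ Finset.Icc 2 ⌊Real.exp t⌋₊,
              (c n / (Real.sqrt n : ℂ)) * ((t : ℂ) - Real.log n))
          + ((Real.log Q : ℂ)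
              + ∑ j : Fin r, (lam j : ℂ) * digammaC ((lam j : ℂ) / 2 + μ j)) * (t : ℂ)
          + ∑ j : Fin r, (lam j : ℂ) ^ 2 *
              (lerchPhiTwo 1 ((lam j : ℂ) / 2 + μ j)
                - Complex.exp (-(t : ℂ) * (1 / 2 + μ j / (lam j : ℂ))) *
                    lerchPhiTwo (Complex.exp (-(t : ℂ) / (lam j : ℂ)))
                      ((lam j : ℂ) / 2 + μ j))) *
          Complex.exp (Complex.I * z * t))
      = 1 / z ^ 2 *
          ((m : ℂ) / (s - 1) + (m : ℂ) / s
            - (∑' n : ℕ, c n * Complex.exp (-s * Real.log n))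
            + (Real.log Q : ℂ)
            + ∑ j : Fin r, (lam j : ℂ) * digammaC ((lam j : ℂ) * s + μ j)) := by
  have hw : 1 / 2 < (-(Complex.I * z)).re := by simpa using hz
  set w : ℂ := -(Complex.I * z) with hw_def
  have hw0 : 0 < w.re := by linarith
  have hwne : w ≠ 0 := fun h => by simp [h] at hw0
  have hsw : s = 1 / 2 + w := by rw [hs, hw_def]; ring
  have hz2 : z ^ 2 = -w ^ 2 := by
    rw [hw_def, neg_sq, mul_pow, Complex.I_sq]
    ring
  have hz1 : Complex.I * z = -w := by rw [hw_def, neg_neg]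
  have hhalf : ((1 / 2 : ℂ)).re < w.re := by simpa using hw
  have hhalf' : ((-1 / 2 : ℂ)).re < w.re := by
    have : ((-1 / 2 : ℂ)).re = -1 / 2 := by norm_num
    linarith
  have hpos (j : Fin r) : 0 < ((lam j : ℂ) / 2 + μ j).re := by
    have h1 : ((lam j : ℂ) / 2).re = lam j / 2 := by simp
    rw [Complex.add_re, h1]
    linarith [hlam j, hμ j]
  have hpole := (((HasLaplace.exp_mul hhalf).add (HasLaplace.exp_mul hhalf')).sub
    ((HasLaplace.one hw0).const_mul 2)).const_mul (4 * (m : ℂ))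
  have hdir := hasLaplace_sum_Icc_floor_exp hc0 hc1 hc hw
  have hlin := (HasLaplace.ofReal hw0).const_mul ((Real.log Q : ℂ)
    + ∑ j : Fin r, (lam j : ℂ) * digammaC ((lam j : ℂ) / 2 + μ j))
  have hlerch := HasLaplace.sum Finset.univ fun j _ => hasLaplace_lerchPhiTwo (hlam j) (hpos j) hw0
  have key := (((hpole.sub hdir).add hlin).add hlerch).congr (g := fun t : ℝ =>
    (4 : ℂ) * (m : ℂ) * (Complex.exp ((t : ℂ) / 2) + Complex.exp (-(t : ℂ) / 2) - 2)
      - (∑ n ∈ Finset.Icc 2 ⌊Real.exp t⌋₊,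
          (c n / (Real.sqrt n : ℂ)) * ((t : ℂ) - Real.log n))
      + ((Real.log Q : ℂ)
          + ∑ j : Fin r, (lam j : ℂ) * digammaC ((lam j : ℂ) / 2 + μ j)) * (t : ℂ)
      + ∑ j : Fin r, (lam j : ℂ) ^ 2 *
          (lerchPhiTwo 1 ((lam j : ℂ) / 2 + μ j)
            - Complex.exp (-(t : ℂ) * (1 / 2 + μ j / (lam j : ℂ))) *
                lerchPhiTwo (Complex.exp (-(t : ℂ) / (lam j : ℂ)))
                  ((lam j : ℂ) / 2 + μ j))) (fun t _ => by
    congr 1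
    · congr 3
      rw [mul_one]
      congr 3 <;> ring
    · refine Finset.sum_congr rfl fun j _ => ?_
      have hl0 : (lam j : ℂ) ≠ 0 := by exact_mod_cast (hlam j).ne'
      have : (1 : ℂ) / 2 + μ j / lam j = ((lam j : ℂ) / 2 + μ j) / lam j := by field_simp
      rw [this])
  rw [hz1, key.2, hz2, hsw]
  have harg (j : Fin r) : (lam j : ℂ) / 2 + μ j + lam j * w = lam j * (1 / 2 + w) + μ j := by ring
  simp only [harg, mul_sub, Finset.sum_sub_distrib, ← Finset.mul_sum]
  have h1 : w - 1 / 2 ≠ 0 := fun h => by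
    rw [sub_eq_zero.mp h] at hhalf
    exact lt_irrefl _ hhalf
  have h2 : w - -1 / 2 ≠ 0 := fun h => by
    rw [sub_eq_zero.mp h] at hhalf'
    exact lt_irrefl _ hhalf'
  have hp : 4 * (m : ℂ) * (1 / (w - 1 / 2) + 1 / (w - -1 / 2)) - 4 * m * (2 * (1 / w))
      = 1 / w ^ 2 * (m / (1 / 2 + w - 1) + m / (1 / 2 + w)) := by
    have e1 : 1 / 2 + w - 1 = w - 1 / 2 := by ring
    have e2 : 1 / 2 + w = w - -1 / 2 := by ring
    rw [e1, e2]
    generalize hu : w - 1 / 2 = u at *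
    generalize hv : w - -1 / 2 = v at *
    have hu' : u = w - 1 / 2 := hu.symm
    have hv' : v = w + 1 / 2 := by rw [← hv]; ring
    field_simp
    rw [hu', hv']
    ring
  rw [hp]
  ring
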